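/- A strictly polytopic system with output matrix C is poly-quadratically detectable if and only if there exist symmetric positive definite matrices P̄_i ∈ ℝ^{n_x×n_x} and matrices X_i ∈ ℝ^{n_x×n_x}, Y_i ∈ ℝ^{n_x×n_y} (i = 1,…,N) such that the 2×2 block matrix [[X_i + X_iᵀ − P̄_j, X_iA_i + Y_iC],[A_iᵀX_iᵀ + CᵀY_iᵀ, P̄_i]] is positive definite for all i, j ∈ {1,…,N}. Moreover, in that case each X_i is non-singular and the observer gain L(k,p) := Σ_{i=1}^N ξ_i(p_k)X_i⁻¹Y_i renders the error system e_{k+1} = (A(p_k) + L(k,p)C)e_k poly-quadratically stable with poly-quadratic Lyapunov function V(π,e) = eᵀP(π)e where P(π) = Σ_{i=1}^N ξ_i(π)P̄_i. -/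

import Mathlib

open Matrix

/-- An observer gain `L(k,p)` renders the error system
`e_{k+1} = (A(p_k) + L(k,p)C)e_k` poly-quadratically stable with poly-quadratic
Lyapunov function `V(π,e) = eᵀP(π)e`, `P(π) = Σᵢ ξᵢ(π)P̄ᵢ`. -/
def RendersErrorPolyQS (nx ny np N : ℕ) (Pset : Set (Fin np → ℝ))
    (ξ : Fin N → Pset → ℝ) (A : Fin N → Matrix (Fin nx) (Fin nx) ℝ)
    (C : Matrix (Fin ny) (Fin nx) ℝ)
    (L : ℕ → (ℕ → Pset) → Matrix (Fin nx) (Fin ny) ℝ)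
    (Pb : Fin N → Matrix (Fin nx) (Fin nx) ℝ) : Prop :=
  ∃ a₁ a₂ a₃ : ℝ, 0 < a₁ ∧ 0 < a₂ ∧ 0 < a₃ ∧
    (∀ (π : Pset) (e : Fin nx → ℝ),
      a₁ * (e ⬝ᵥ e) ≤ e ⬝ᵥ ((∑ i, ξ i π • Pb i) *ᵥ e) ∧
      e ⬝ᵥ ((∑ i, ξ i π • Pb i) *ᵥ e) ≤ a₂ * (e ⬝ᵥ e)) ∧
    (∀ (p : ℕ → Pset) (k : ℕ) (e : Fin nx → ℝ),
      (((∑ i, ξ i (p k) • A i) + L k p * C) *ᵥ e) ⬝ᵥ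
          ((∑ i, ξ i (p (k + 1)) • Pb i) *ᵥ
            (((∑ i, ξ i (p k) • A i) + L k p * C) *ᵥ e))
        ≤ e ⬝ᵥ ((∑ i, ξ i (p k) • Pb i) *ᵥ e) - a₃ * (e ⬝ᵥ e))

/-- The polytopic system with output matrix `C` is poly-quadratically
detectable. -/
def PolyQDetectable (nx ny np N : ℕ) (Pset : Set (Fin np → ℝ))
    (ξ : Fin N → Pset → ℝ) (A : Fin N → Matrix (Fin nx) (Fin nx) ℝ)
    (C : Matrix (Fin ny) (Fin nx) ℝ) : Prop :=
  ∃ (L : ℕ → (ℕ → Pset) → Matrix (Fin nx) (Fin ny) ℝ)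
    (Pb : Fin N → Matrix (Fin nx) (Fin nx) ℝ),
    (∀ i, (Pb i).IsSymm) ∧ RendersErrorPolyQS nx ny np N Pset ξ A C L Pb

theorem Finite.exists_pos_forall_lt {ι : Type*} [Finite ι] {f : ι → ℝ}
    (hf : ∀ i, 0 < f i) : ∃ b, 0 < b ∧ ∀ i, b < f i := by
  obtain ⟨⟨b, hb⟩, h⟩ := Finite.exists_ge fun i => (⟨f i, hf i⟩ : Set.Ioi (0 : ℝ))
  exact ⟨b / 2, half_pos hb, fun i => (half_lt_self hb).trans_le (h i)⟩

namespace Matrix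

section QuadraticForms

variable {m n : Type*} [Fintype m] [Fintype n]

/-- Strict version of the Schur complement criterion `Matrix.PosDef.fromBlocks₁₁`. -/
theorem posDef_fromBlocks_iff₁₁ [DecidableEq m] {A : Matrix m m ℝ} (hA : A.PosDef)
    (B : Matrix m n ℝ) (D : Matrix n n ℝ) :
    (fromBlocks A B Bᵀ D).PosDef ↔ (D - Bᵀ * A⁻¹ * B).PosDef := by
  have := hA.isUnit.invertible
  rw [← conjTranspose_eq_transpose_of_trivial, posDef_iff_dotProduct_mulVec,
    IsHermitian.fromBlocks₁₁ _ _ hA.1]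
  constructor
  · refine fun h => .of_dotProduct_mulVec_pos h.1 fun x hx => ?_
    have hne : -((A⁻¹ * B) *ᵥ x) ⊕ᵥ x ≠ 0 := fun h0 => hx <| funext fun i => congrFun h0 (.inr i)
    have := h.2 hne
    rwa [dotProduct_mulVec, schur_complement_eq₁₁ B D _ _ hA.1, neg_add_cancel, dotProduct_zero,
      zero_add, ← dotProduct_mulVec] at this
  · refine fun h => ⟨h.1, fun x hx => ?_⟩
    rw [dotProduct_mulVec, ← Sum.elim_comp_inl_inr x, schur_complement_eq₁₁ B D _ _ hA.1,
      ← dotProduct_mulVec, ← dotProduct_mulVec (star (x ∘ Sum.inr))]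
    by_cases hy : x ∘ Sum.inr = 0
    · have hx' : x ∘ Sum.inl ≠ 0 := fun h0 => hx <| by
        rw [← Sum.elim_comp_inl_inr x, h0, hy]
        ext (i | i) <;> rfl
      simpa [hy] using hA.dotProduct_mulVec_pos hx'
    · exact add_pos_of_nonneg_of_pos (hA.posSemidef.dotProduct_mulVec_nonneg _)
        (h.dotProduct_mulVec_pos hy)

/-- Strict version of the Schur complement criterion `Matrix.PosDef.fromBlocks₂₂`. -/
theorem posDef_fromBlocks_iff₂₂ [DecidableEq n] (A : Matrix m m ℝ) (B : Matrix m n ℝ)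
    {D : Matrix n n ℝ} (hD : D.PosDef) :
    (fromBlocks A B Bᵀ D).PosDef ↔ (A - B * D⁻¹ * Bᵀ).PosDef := by
  have hswap : (fromBlocks D Bᵀ B A).PosDef ↔ (fromBlocks A B Bᵀ D).PosDef := by
    constructor <;> intro h
    · simpa using h.submatrix (Equiv.sumComm m n).injective
    · simpa using h.submatrix (Equiv.sumComm n m).injective
  rw [← hswap]
  simpa using posDef_fromBlocks_iff₁₁ hD Bᵀ A

/-- The two Schur complements of a block matrix with positive definite diagonal blocks are
simultaneously positive definite. -/
theorem PosDef.sub_transpose_mul_mul_iff [DecidableEq m] [DecidableEq n] {P : Matrix m m ℝ}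
    {Q : Matrix n n ℝ} (hP : P.PosDef) (hQ : Q.PosDef) (B : Matrix m n ℝ) :
    (Q - Bᵀ * P * B).PosDef ↔ (P⁻¹ - B * Q⁻¹ * Bᵀ).PosDef := by
  have := posDef_fromBlocks_iff₁₁ hP.inv B Q
  rw [nonsing_inv_nonsing_inv _ ((isUnit_iff_isUnit_det _).1 hP.isUnit)] at this
  rw [← this, posDef_fromBlocks_iff₂₂ _ _ hQ]

theorem isCompact_setOf_dotProduct_self_eq_one : IsCompact {x : n → ℝ | x ⬝ᵥ x = 1} := by
  refine (isCompact_univ_pi fun _ : n => isCompact_Icc (a := (-1 : ℝ)) (b := 1)).of_isClosed_subset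
    (isClosed_eq (by unfold dotProduct; fun_prop) continuous_const) fun x hx i _ => ?_
  have h : x i * x i ≤ x ⬝ᵥ x :=
    Finset.single_le_sum (f := fun i => x i * x i) (fun j _ => mul_self_nonneg _)
      (Finset.mem_univ i)
  rw [Set.mem_ofPred_eq] at hx
  exact abs_le.1 (abs_le_one_iff_mul_self_le_one.2 (h.trans hx.le))

theorem inv_sqrt_smul_dotProduct_self {x : n → ℝ} (hx : 0 < x ⬝ᵥ x) :
    ((√(x ⬝ᵥ x))⁻¹ • x) ⬝ᵥ ((√(x ⬝ᵥ x))⁻¹ • x) = 1 := by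
  rw [smul_dotProduct, dotProduct_smul, smul_smul, ← mul_inv, Real.mul_self_sqrt hx.le,
    smul_eq_mul, inv_mul_cancel₀ (ne_of_gt hx)]

/-- A quadratic form is bounded below by a multiple of `x ⬝ᵥ x`, which is positive if the form is
positive definite. -/
theorem exists_mul_dotProduct_self_le (M : Matrix n n ℝ) :
    ∃ c : ℝ, (∀ x, c * (x ⬝ᵥ x) ≤ x ⬝ᵥ (M *ᵥ x)) ∧ (M.PosDef → 0 < c) := by
  rcases Set.eq_empty_or_nonempty {x : n → ℝ | x ⬝ᵥ x = 1} with hK | hK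
  · refine ⟨1, fun x => ?_, fun _ => one_pos⟩
    suffices x = 0 by simp [this]
    by_contra hx
    have hpos : 0 < x ⬝ᵥ x := by simpa using dotProduct_star_self_pos_iff.2 hx
    exact Set.eq_empty_iff_forall_notMem.1 hK _ (inv_sqrt_smul_dotProduct_self hpos)
  · obtain ⟨z, hz, hmin⟩ := isCompact_setOf_dotProduct_self_eq_one.exists_isMinOn hK
      (f := fun x => x ⬝ᵥ (M *ᵥ x)) (by unfold mulVec dotProduct; fun_prop)
    refine ⟨z ⬝ᵥ (M *ᵥ z), fun x => ?_, fun hM => ?_⟩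
    · rcases eq_or_ne x 0 with rfl | hx
      · simp
      have hpos : 0 < x ⬝ᵥ x := by simpa using dotProduct_star_self_pos_iff.2 hx
      have h := isMinOn_iff.1 hmin _ (inv_sqrt_smul_dotProduct_self hpos)
      rw [mulVec_smul, smul_dotProduct, dotProduct_smul, smul_smul, ← mul_inv,
        Real.mul_self_sqrt hpos.le, smul_eq_mul] at h
      rwa [← le_div_iff₀ hpos, div_eq_inv_mul]
    · have hz0 : z ≠ 0 := by
        rintro rfl
        simp at hz
      simpa using hM.dotProduct_mulVec_pos hz0

theorem exists_dotProduct_mulVec_le (M : Matrix n n ℝ) :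
    ∃ d : ℝ, 0 < d ∧ ∀ x, x ⬝ᵥ (M *ᵥ x) ≤ d * (x ⬝ᵥ x) := by
  obtain ⟨c, hc, -⟩ := exists_mul_dotProduct_self_le (-M)
  refine ⟨|c| + 1, by positivity, fun x => ?_⟩
  have h := hc x
  rw [neg_mulVec, dotProduct_neg] at h
  have hx : 0 ≤ x ⬝ᵥ x := by simpa using dotProduct_star_self_nonneg x
  nlinarith [neg_abs_le c]

theorem PosDef.exists_pos_mul_dotProduct_self_le {M : Matrix n n ℝ} (hM : M.PosDef) :
    ∃ c : ℝ, 0 < c ∧ ∀ x, c * (x ⬝ᵥ x) ≤ x ⬝ᵥ (M *ᵥ x) :=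
  let ⟨c, hc, hpos⟩ := exists_mul_dotProduct_self_le M
  ⟨c, hpos hM, hc⟩

/-- Finitely many positive definite matrices have a common positive lower bound. -/
theorem exists_uniform_pos_mul_dotProduct_self_le {ι : Type*} [Finite ι] {M : ι → Matrix n n ℝ}
    (hM : ∀ i, (M i).PosDef) :
    ∃ c : ℝ, 0 < c ∧ ∀ i x, c * (x ⬝ᵥ x) ≤ x ⬝ᵥ (M i *ᵥ x) := by
  choose c hc hcM using fun i => (hM i).exists_pos_mul_dotProduct_self_le
  obtain ⟨b, hb, hbc⟩ := Finite.exists_pos_forall_lt hc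
  refine ⟨b, hb, fun i x => (mul_le_mul_of_nonneg_right (hbc i).le ?_).trans (hcM i x)⟩
  simpa using dotProduct_star_self_nonneg x

/-- Positive definiteness is stable under small Hermitian perturbations. -/
theorem PosDef.exists_pos_sub_smul {M T : Matrix n n ℝ} (hM : M.PosDef) (hT : T.IsHermitian) :
    ∃ δ : ℝ, 0 < δ ∧ ∀ ε, 0 < ε → ε < δ → (M - ε • T).PosDef := by
  obtain ⟨c, hc, hcM⟩ := hM.exists_pos_mul_dotProduct_self_le
  obtain ⟨d, hd, hdT⟩ := exists_dotProduct_mulVec_le T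
  refine ⟨c / d, by positivity, fun ε hε hlt => .of_dotProduct_mulVec_pos
    (hM.1.sub (hT.smul (IsSelfAdjoint.all ε))) fun x hx => ?_⟩
  have hpos : 0 < x ⬝ᵥ x := by simpa using dotProduct_star_self_pos_iff.2 hx
  rw [lt_div_iff₀ hd] at hlt
  rw [star_trivial, sub_mulVec, smul_mulVec, dotProduct_sub, dotProduct_smul, smul_eq_mul]
  nlinarith [hcM x, mul_le_mul_of_nonneg_left (hdT x) hε.le, mul_lt_mul_of_pos_right hlt hpos]

theorem PosSemidef.convexOn_dotProduct_mulVec {P : Matrix n n ℝ} (hP : P.PosSemidef) :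
    ConvexOn ℝ Set.univ fun x : n → ℝ => x ⬝ᵥ (P *ᵥ x) := by
  refine ⟨convex_univ, fun x _ y _ a b ha hb hab => ?_⟩
  have h := hP.dotProduct_mulVec_nonneg (x - y)
  obtain rfl : b = 1 - a := by linarith
  simp only [star_trivial, mulVec_sub, dotProduct_sub, sub_dotProduct, mulVec_add, mulVec_smul,
    dotProduct_add, add_dotProduct, smul_dotProduct, dotProduct_smul, smul_eq_mul] at h ⊢
  nlinarith [mul_nonneg (mul_nonneg ha hb) h]

theorem dotProduct_sum_smul_mulVec {ι : Type*} [Fintype ι] (w : ι → ℝ) (M : ι → Matrix n n ℝ)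
    (x : n → ℝ) : x ⬝ᵥ ((∑ i, w i • M i) *ᵥ x) = ∑ i, w i * (x ⬝ᵥ (M i *ᵥ x)) := by
  simp [sum_mulVec, dotProduct_sum, smul_mulVec]

end QuadraticForms

section ObserverDesign

variable {m n : Type*} [Fintype m] [Fintype n]

/-- The regularised Kalman gain minimises `(A + LC) S (A + LC)ᵀ + ε LLᵀ` in the Loewner order. -/
theorem PosDef.exists_optimal_gain {S : Matrix n n ℝ} (hS : S.PosDef) (A : Matrix n n ℝ)
    (C : Matrix m n ℝ) {ε : ℝ} (hε : 0 < ε) :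
    ∃ L : Matrix n m ℝ, ∀ L' : Matrix n m ℝ,
      (((A + L' * C) * S * (A + L' * C)ᵀ + ε • (L' * L'ᵀ)) -
        ((A + L * C) * S * (A + L * C)ᵀ + ε • (L * Lᵀ))).PosSemidef := by
  classical
  set R : Matrix m m ℝ := C * S * Cᵀ + ε • 1
  have hR : R.PosDef := by
    refine PosDef.posSemidef_add ?_ (PosDef.one.smul hε)
    simpa using hS.posSemidef.mul_mul_conjTranspose_same C
  have hSt : Sᵀ = S := by simpa using hS.1.eq
  set L : Matrix n m ℝ := -(A * S * Cᵀ * R⁻¹) with hLdef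
  have hLR : L * R = -(A * S * Cᵀ) := by
    rw [hLdef, Matrix.neg_mul, Matrix.mul_assoc _ R⁻¹ R,
      nonsing_inv_mul _ ((isUnit_iff_isUnit_det _).1 hR.isUnit), Matrix.mul_one]
  have hL : (A + L * C) * S * Cᵀ + ε • L = 0 := by
    have : L * C * S * Cᵀ + ε • L = -(A * S * Cᵀ) := by
      rw [← hLR]
      simp [R, Matrix.mul_add, Matrix.mul_assoc]
    rw [Matrix.add_mul, Matrix.add_mul, add_assoc, this, add_neg_cancel]
  have hLt : C * S * (A + L * C)ᵀ + ε • Lᵀ = 0 := by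
    have h := congrArg (fun M => Mᵀ) hL
    simp only [transpose_add, transpose_mul, transpose_transpose, transpose_smul, hSt,
      transpose_zero] at h
    simpa [Matrix.mul_assoc] using h
  refine ⟨L, fun L' => ?_⟩
  have key : ((A + L' * C) * S * (A + L' * C)ᵀ + ε • (L' * L'ᵀ)) -
      ((A + L * C) * S * (A + L * C)ᵀ + ε • (L * Lᵀ)) = (L' - L) * R * (L' - L)ᵀ := by
    obtain ⟨D, rfl⟩ : ∃ D, L' = L + D := ⟨L' - L, by abel⟩
    have h1 : A + (L + D) * C = (A + L * C) + D * C := by rw [Matrix.add_mul, add_assoc]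
    rw [h1]
    generalize A + L * C = B at hL hLt
    have e1 : B * S * Cᵀ * Dᵀ + ε • (L * Dᵀ) = 0 := by
      rw [← Matrix.smul_mul, ← Matrix.add_mul, hL, Matrix.zero_mul]
    have e2 : D * C * S * Bᵀ + ε • (D * Lᵀ) = 0 := by
      rw [← Matrix.mul_smul, Matrix.mul_assoc D, Matrix.mul_assoc D, ← Matrix.mul_add, hLt,
        Matrix.mul_zero]
    calc _ = (B * S * Cᵀ * Dᵀ + ε • (L * Dᵀ)) + (D * C * S * Bᵀ + ε • (D * Lᵀ)) +
          (D * C * S * Cᵀ * Dᵀ + ε • (D * Dᵀ)) := by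
          simp only [transpose_add, transpose_mul, Matrix.add_mul, Matrix.mul_add, smul_add,
            Matrix.mul_assoc]
          abel
      _ = _ := by
          rw [e1, e2]
          simp [R, Matrix.mul_add, Matrix.add_mul, Matrix.mul_assoc]
  rw [key]
  simpa using hR.posSemidef.mul_mul_conjTranspose_same (L' - L)

variable [DecidableEq n]

/-- If every `P j` admits its own gain `L' j` that makes `A + L' j * C` a contraction from the
norm of `Q` to that of `P j`, then the synthesis inequalities have a solution that does not depend
on `j`. -/
theorem PosDef.exists_synthesis {ι : Type*} [Finite ι] {Q : Matrix n n ℝ} (hQ : Q.PosDef)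
    {P : ι → Matrix n n ℝ} (hP : ∀ j, (P j).PosDef) (A : Matrix n n ℝ) (C : Matrix m n ℝ)
    (L' : ι → Matrix n m ℝ)
    (h : ∀ j, (Q - (A + L' j * C)ᵀ * P j * (A + L' j * C)).PosDef) :
    ∃ (X : Matrix n n ℝ) (Y : Matrix n m ℝ), ∀ j,
      (fromBlocks (X + Xᵀ - P j) (X * A + Y * C) (Aᵀ * Xᵀ + Cᵀ * Yᵀ) Q).PosDef := by
  have hLL (L : Matrix n m ℝ) : (L * Lᵀ + 1).PosDef := by
    simpa using PosDef.posSemidef_add (posSemidef_self_mul_conjTranspose L) PosDef.one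
  choose δ hδ hδP using fun j =>
    (((hP j).sub_transpose_mul_mul_iff hQ _).1 (h j)).exists_pos_sub_smul (hLL (L' j)).1
  obtain ⟨ε, hε, hεδ⟩ := Finite.exists_pos_forall_lt hδ
  obtain ⟨L, hL⟩ := hQ.inv.exists_optimal_gain A C hε
  set B := A + L * C
  set W := B * Q⁻¹ * Bᵀ + ε • (L * Lᵀ + 1) with hWdef
  have hW : W.PosDef := by
    refine PosDef.posSemidef_add ?_ ((hLL L).smul hε)
    simpa using hQ.inv.posSemidef.mul_mul_conjTranspose_same B
  have hWdet := (isUnit_iff_isUnit_det _).1 hW.isUnit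
  have hXt : (W⁻¹)ᵀ = W⁻¹ := by simpa using hW.inv.1.eq
  have hPW (j) : ((P j)⁻¹ - W).PosDef := by
    convert (hδP j ε hε (hεδ j)).add_posSemidef (hL (L' j)) using 1
    simp only [W, B, smul_add]
    abel
  refine ⟨W⁻¹, W⁻¹ * L, fun j => ?_⟩
  have hXP : (W⁻¹ - P j).PosDef := by
    have := ((hP j).sub_transpose_mul_mul_iff hW.inv 1).2
    simp only [transpose_one, Matrix.one_mul, Matrix.mul_one,
      nonsing_inv_nonsing_inv _ hWdet] at this
    exact this (hPW j)
  have hoff : W⁻¹ * A + W⁻¹ * L * C = W⁻¹ * B := by simp [B, Matrix.mul_add, Matrix.mul_assoc]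
  have hoff' : Aᵀ * (W⁻¹)ᵀ + Cᵀ * (W⁻¹ * L)ᵀ = (W⁻¹ * B)ᵀ := by
    rw [← hoff]
    simp
  rw [hoff, hoff', posDef_fromBlocks_iff₂₂ _ _ hQ]
  have hrest : (W⁻¹ * (ε • (L * Lᵀ + 1)) * (W⁻¹)ᵀ).PosSemidef := by
    simpa using ((hLL L).smul hε).posSemidef.mul_mul_conjTranspose_same W⁻¹
  convert hXP.add_posSemidef hrest using 1
  have hsub : ε • (L * Lᵀ + 1) = W - B * Q⁻¹ * Bᵀ := by rw [hWdef]; abel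
  rw [hsub, Matrix.mul_sub, Matrix.sub_mul, nonsing_inv_mul _ hWdet, Matrix.one_mul, hXt,
    transpose_mul, hXt]
  simp only [Matrix.mul_assoc]
  abel

theorem isUnit_of_posDef_add_transpose {X : Matrix n n ℝ} (h : (X + Xᵀ).PosDef) : IsUnit X := by
  rw [← mulVec_injective_iff_isUnit]
  refine (injective_iff_map_eq_zero (mulVecLin X)).2 fun v hv => ?_
  rw [mulVecLin_apply] at hv
  by_contra hne
  have := h.dotProduct_mulVec_pos hne
  rw [star_trivial, add_mulVec, dotProduct_add, dotProduct_mulVec v Xᵀ, vecMul_transpose, hv] at this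
  simp at this

/-- The `(1,1)` block of the synthesis inequality forces `X` to be non-singular. -/
theorem isUnit_of_posDef_synthesis {P Q X : Matrix n n ℝ} {Z Z' : Matrix n n ℝ} (hP : P.PosDef)
    (h : (fromBlocks (X + Xᵀ - P) Z Z' Q).PosDef) : IsUnit X := by
  refine isUnit_of_posDef_add_transpose ?_
  have h₁₁ : (X + Xᵀ - P).PosDef := h.submatrix (e := Sum.inl) Sum.inl_injective
  simpa using h₁₁.add hP

/-- A solution of the synthesis inequality yields a strict decrease of the Lyapunov function. -/
theorem posDef_sub_of_posDef_synthesis {P Q X A : Matrix n n ℝ} {Y : Matrix n m ℝ}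
    {C : Matrix m n ℝ} (hX : IsUnit X)
    (h : (fromBlocks (X + Xᵀ - P) (X * A + Y * C) (Aᵀ * Xᵀ + Cᵀ * Yᵀ) Q).PosDef) :
    (Q - (A + X⁻¹ * Y * C)ᵀ * P * (A + X⁻¹ * Y * C)).PosDef := by
  set B := A + X⁻¹ * Y * C
  have hoff : X * A + Y * C = X * B := by
    rw [Matrix.mul_add, Matrix.mul_assoc X⁻¹, mul_nonsing_inv_cancel_left _ _
      ((isUnit_iff_isUnit_det _).1 hX)]
  have hoff' : Aᵀ * Xᵀ + Cᵀ * Yᵀ = Bᵀ * Xᵀ := by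
    rw [← transpose_mul X B, ← hoff]
    simp
  rw [hoff, hoff'] at h
  have hT : Function.Injective (fromRows (-B) (1 : Matrix n n ℝ)).mulVec := fun x y hxy => by
    simp only [fromRows_mulVec, one_mulVec] at hxy
    exact funext fun i => congrFun hxy (.inr i)
  convert h.conjTranspose_mul_mul_same hT using 1
  rw [conjTranspose_eq_transpose_of_trivial, transpose_fromRows, fromCols_mul_fromBlocks,
    fromCols_mul_fromRows]
  simp only [transpose_neg, transpose_one, Matrix.one_mul, Matrix.mul_one, Matrix.neg_mul,
    Matrix.mul_neg, Matrix.mul_add, Matrix.add_mul, Matrix.mul_sub, Matrix.sub_mul,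
    Matrix.mul_assoc]
  abel

end ObserverDesign

end Matrix

/-- Vertex-wise strict decrease extends to the whole polytope. -/
theorem rendersErrorPolyQS_of_posDef {nx ny np N : ℕ} {Pset : Set (Fin np → ℝ)}
    {ξ : Fin N → Pset → ℝ} (hξ0 : ∀ i π, 0 ≤ ξ i π) (hξ1 : ∀ π, ∑ i, ξ i π = 1)
    {A : Fin N → Matrix (Fin nx) (Fin nx) ℝ} {C : Matrix (Fin ny) (Fin nx) ℝ}
    {K : Fin N → Matrix (Fin nx) (Fin ny) ℝ} {Pb : Fin N → Matrix (Fin nx) (Fin nx) ℝ}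
    (hP : ∀ i, (Pb i).PosDef)
    (h : ∀ i j, (Pb i - (A i + K i * C)ᵀ * Pb j * (A i + K i * C)).PosDef) :
    RendersErrorPolyQS nx ny np N Pset ξ A C (fun k p => ∑ i, ξ i (p k) • K i) Pb := by
  obtain ⟨a₁, ha₁, hlow⟩ := exists_uniform_pos_mul_dotProduct_self_le hP
  choose d hd hup using fun i => exists_dotProduct_mulVec_le (Pb i)
  obtain ⟨a₃, ha₃, hdec⟩ := exists_uniform_pos_mul_dotProduct_self_le
    (fun q : Fin N × Fin N => h q.1 q.2)
  have hd1 (i) : d i ≤ ∑ j, d j + 1 :=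
    (Finset.single_le_sum (fun j _ => (hd j).le) (Finset.mem_univ i)).trans (by linarith)
  have hcomb (π : Pset) (c : ℝ) : ∑ i, ξ i π * c = c := by rw [← Finset.sum_mul, hξ1, one_mul]
  refine ⟨a₁, ∑ j, d j + 1, a₃, ha₁, ?_, ha₃, fun π e => ⟨?_, ?_⟩, fun p k e => ?_⟩
  · linarith [Finset.sum_nonneg fun i (_ : i ∈ Finset.univ) => (hd i).le]
  · rw [dotProduct_sum_smul_mulVec, ← hcomb π (a₁ * _)]
    exact Finset.sum_le_sum fun i _ => mul_le_mul_of_nonneg_left (hlow i e) (hξ0 i π)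
  · rw [dotProduct_sum_smul_mulVec, ← hcomb π (_ * (e ⬝ᵥ e))]
    refine Finset.sum_le_sum fun i _ => mul_le_mul_of_nonneg_left ((hup i e).trans ?_) (hξ0 i π)
    exact mul_le_mul_of_nonneg_right (hd1 i) (by simpa using dotProduct_star_self_nonneg e)
  · have hcl : ((∑ i, ξ i (p k) • A i) + (∑ i, ξ i (p k) • K i) * C) *ᵥ e =
        ∑ i, ξ i (p k) • ((A i + K i * C) *ᵥ e) := by
      simp [Matrix.sum_mul, ← Finset.sum_add_distrib, sum_mulVec, smul_mulVec, add_mulVec]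
    rw [hcl, dotProduct_sum_smul_mulVec, ← hcomb (p (k + 1)) (_ - _)]
    refine Finset.sum_le_sum fun j _ => mul_le_mul_of_nonneg_left ?_ (hξ0 j _)
    refine ((hP j).posSemidef.convexOn_dotProduct_mulVec.map_sum_le (fun i _ => hξ0 i (p k))
      (hξ1 _) (fun _ _ => Set.mem_univ _)).trans ?_
    rw [dotProduct_sum_smul_mulVec, ← hcomb (p k) (a₃ * _), ← Finset.sum_sub_distrib]
    refine Finset.sum_le_sum fun i _ => ?_
    rw [smul_eq_mul, ← mul_sub]
    refine mul_le_mul_of_nonneg_left ?_ (hξ0 i _)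
    have := hdec (i, j) e
    rw [sub_mulVec, dotProduct_sub, Matrix.mul_assoc, ← mulVec_mulVec, dotProduct_mulVec e (_ᵀ),
      vecMul_transpose, ← mulVec_mulVec] at this
    linarith

/-- At the vertices of a strictly polytopic system, detectability yields positive definite
`Pb i` together with gains that may depend on both the current and the next vertex. -/
theorem RendersErrorPolyQS.exists_vertex_gain {nx ny np N : ℕ} {Pset : Set (Fin np → ℝ)}
    {ξ : Fin N → Pset → ℝ}
    (hstrict : ∀ i : Fin N, ∃ π : Pset, ∀ j, ξ j π = if j = i then 1 else 0)
    {A : Fin N → Matrix (Fin nx) (Fin nx) ℝ} {C : Matrix (Fin ny) (Fin nx) ℝ}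
    {L : ℕ → (ℕ → Pset) → Matrix (Fin nx) (Fin ny) ℝ} {Pb : Fin N → Matrix (Fin nx) (Fin nx) ℝ}
    (hsymm : ∀ i, (Pb i).IsSymm) (h : RendersErrorPolyQS nx ny np N Pset ξ A C L Pb) :
    (∀ i, (Pb i).PosDef) ∧ ∀ i, ∃ K : Fin N → Matrix (Fin nx) (Fin ny) ℝ,
      ∀ j, (Pb i - (A i + K j * C)ᵀ * Pb j * (A i + K j * C)).PosDef := by
  obtain ⟨a₁, a₂, a₃, ha₁, -, ha₃, hbd, hdec⟩ := h
  choose v hv using hstrict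
  have hvert (M : Fin N → Matrix (Fin nx) (Fin nx) ℝ) (i) : ∑ j, ξ j (v i) • M j = M i := by
    simp [hv]
  have hherm (i) : (Pb i).IsHermitian := by simpa [IsHermitian] using (hsymm i).eq
  have hpos {e : Fin nx → ℝ} (he : e ≠ 0) : 0 < e ⬝ᵥ e := by
    simpa using dotProduct_star_self_pos_iff.2 he
  refine ⟨fun i => .of_dotProduct_mulVec_pos (hherm i) fun e he => ?_, fun i => ?_⟩
  · have := (hbd (v i) e).1
    rw [hvert] at this
    exact (mul_pos ha₁ (hpos he)).trans_le this
  · refine ⟨fun j => L 0 fun k => if k = 0 then v i else v j, fun j => ?_⟩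
    refine .of_dotProduct_mulVec_pos ((hherm i).sub ?_) fun e he => ?_
    · exact isHermitian_conjTranspose_mul_mul _ (hherm j)
    · have := hdec (fun k => if k = 0 then v i else v j) 0 e
      simp only [zero_add, one_ne_zero, if_true, if_false, hvert] at this
      rw [star_trivial, sub_mulVec, dotProduct_sub, Matrix.mul_assoc, ← mulVec_mulVec,
        dotProduct_mulVec e (_ᵀ), vecMul_transpose, ← mulVec_mulVec]
      linarith [mul_pos ha₃ (hpos he)]

/-- A strictly polytopic system is poly-quadratically detectable iff the
observer-synthesis LMIs are feasible; moreover, for any feasible solution each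
`Xᵢ` is non-singular and the observer gain `L(k,p) = Σᵢ ξᵢ(p_k)Xᵢ⁻¹Yᵢ` renders
the error system poly-quadratically stable with poly-QLF `V(π,e) = eᵀP(π)e`,
`P(π) = Σᵢ ξᵢ(π)P̄ᵢ`. -/
theorem polyQ_detectability_iff_synthesis_lmi (nx ny np N : ℕ)
    (hnx : 0 < nx) (hny : 0 < ny) (hnp : 0 < np) (hN : 0 < N)
    (Pset : Set (Fin np → ℝ)) (hPc : IsCompact Pset)
    (ξ : Fin N → Pset → ℝ)
    (hξc : ∀ i, Continuous (ξ i))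
    (hξ0 : ∀ i π, 0 ≤ ξ i π)
    (hξ1 : ∀ π, ∑ i, ξ i π = 1)
    (hstrict : ∀ i : Fin N, ∃ π : Pset, ∀ j, ξ j π = if j = i then 1 else 0)
    (A : Fin N → Matrix (Fin nx) (Fin nx) ℝ)
    (C : Matrix (Fin ny) (Fin nx) ℝ) :
    (PolyQDetectable nx ny np N Pset ξ A C ↔
      ∃ (Pb X : Fin N → Matrix (Fin nx) (Fin nx) ℝ)
        (Y : Fin N → Matrix (Fin nx) (Fin ny) ℝ),
        (∀ i, (Pb i).PosDef) ∧
        ∀ i j, (fromBlocks (X i + (X i)ᵀ - Pb j) (X i * A i + Y i * C)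
            ((A i)ᵀ * (X i)ᵀ + Cᵀ * (Y i)ᵀ) (Pb i)).PosDef) ∧
    (∀ (Pb X : Fin N → Matrix (Fin nx) (Fin nx) ℝ)
       (Y : Fin N → Matrix (Fin nx) (Fin ny) ℝ),
      (∀ i, (Pb i).PosDef) →
      (∀ i j, (fromBlocks (X i + (X i)ᵀ - Pb j) (X i * A i + Y i * C)
          ((A i)ᵀ * (X i)ᵀ + Cᵀ * (Y i)ᵀ) (Pb i)).PosDef) →
      (∀ i, IsUnit (X i)) ∧
      RendersErrorPolyQS nx ny np N Pset ξ A C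
        (fun k p => ∑ i, ξ i (p k) • ((X i)⁻¹ * Y i)) Pb) := by
  have hmain (Pb X : Fin N → Matrix (Fin nx) (Fin nx) ℝ) (Y : Fin N → Matrix (Fin nx) (Fin ny) ℝ)
      (hP : ∀ i, (Pb i).PosDef)
      (h : ∀ i j, (fromBlocks (X i + (X i)ᵀ - Pb j) (X i * A i + Y i * C)
          ((A i)ᵀ * (X i)ᵀ + Cᵀ * (Y i)ᵀ) (Pb i)).PosDef) :
      (∀ i, IsUnit (X i)) ∧
      RendersErrorPolyQS nx ny np N Pset ξ A C
        (fun k p => ∑ i, ξ i (p k) • ((X i)⁻¹ * Y i)) Pb := by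
    have hX (i) : IsUnit (X i) := isUnit_of_posDef_synthesis (hP i) (h i i)
    exact ⟨hX, rendersErrorPolyQS_of_posDef hξ0 hξ1 hP fun i j =>
      posDef_sub_of_posDef_synthesis (hX i) (h i j)⟩
  refine ⟨⟨?_, ?_⟩, hmain⟩
  · rintro ⟨L, Pb, hsymm, hL⟩
    obtain ⟨hP, hK⟩ := hL.exists_vertex_gain hstrict hsymm
    choose K hK using hK
    choose X Y hXY using fun i => (hP i).exists_synthesis hP (A i) C (K i) (hK i)
    exact ⟨Pb, X, Y, hP, hXY⟩
  · rintro ⟨Pb, X, Y, hP, h⟩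
    exact ⟨_, Pb, fun i => by simpa using (hP i).1, (hmain Pb X Y hP h).2⟩
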